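/- arXiv:2404.03933 — 3 statements merged into one kernel-verified Lean document; each statement's English description precedes it below -/
import Mathlib

section
/- Fix an odd integer l ≥ 3, N₀ ∈ {0, …, 2l−1}, k₀ ∈ {0, …, l−1}, and a real α > 0. Let (k₁(n))_{n≥1} be nonnegative integers with k₁(n) ≡ N₀ + k₀ (mod 2) for all n and k₁(n)/√(2n) → α as n → ∞. For each n set N(n) := 2ln + N₀, k(n) := k₁(n)l + k₀, and p_n := M^{(l)}_{k(n)}(N(n)) · d(k(n)) / 2^{N(n)}, where for k = k₁l + k₀ the dimension is d(k) := k₀+1 if k₁ = 0, d(k) := l(k₁+1) if k₁ ≥ 1 and k₀ = l−1, and d(k) := 2k₁l if k₁ ≥ 1 and 0 ≤ k₀ ≤ l−2. Then lim_{n→∞} √(n/2) · p_n = p₁(k₀) · p₂(α), where p₁(k₀) := 2(l−1−k₀)/l² for 0 ≤ k₀ ≤ l−2, p₁(l−1) := 1/l, and p₂(α) := √(2/π) · l^{3/2} · α² · e^{−α² l/2}. -/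
/-- `intBinom N j = binom(N, j)` for an integer `j`, with the convention that it vanishes
for `j < 0` or `j > N`. -/
def intBinom (N : ℕ) (j : ℤ) : ℤ :=
  if 0 ≤ j ∧ j ≤ (N : ℤ) then (N.choose j.toNat : ℤ) else 0

/-- `Fcoef N k = F^{(N)}_k = binom(N,(N−k)/2) − binom(N,(N−k−2)/2)` if `k ≡ N (mod 2)`,
and `0` otherwise. -/
def Fcoef (N : ℕ) (k : ℤ) : ℤ :=
  if ((N : ℤ) - k) % 2 = 0 then
    intBinom N (((N : ℤ) - k) / 2) - intBinom N (((N : ℤ) - k - 2) / 2)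
  else 0

/-- The multiplicity `M^{(l)}_k(N)` of the tilting module `T(k)` in `T(1)^{⊗N}`.
Writing `k = k₁ l + k₀` with `0 ≤ k₀ ≤ l−1`, it is `F^{(N)}_k` when `k₀ = l−1`, and
`Σ_{j≥0} (F^{(N)}_{k+2jl} − F^{(N)}_{(k₁+2j+2)l−k₀−2})` when `0 ≤ k₀ ≤ l−2`; all terms of the
infinite sum with `j > N` vanish, so it is truncated at `j = N`. -/
def Mmult (l k N : ℕ) : ℤ :=
  if k % l = l - 1 then Fcoef N k
  else ∑ j ∈ Finset.range (N + 1),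
    (Fcoef N ((k : ℤ) + 2 * j * l) -
      Fcoef N ((((k / l : ℕ) : ℤ) + 2 * (j : ℤ) + 2) * l - ((k % l : ℕ) : ℤ) - 2))

open Filter Real

/-- The dimension `d(k)` of the indecomposable tilting module `T(k)`,
where `k = k₁ l + k₀` with `0 ≤ k₀ ≤ l−1`: it is `k₀+1` if `k₁ = 0`, `l(k₁+1)` if `k₁ ≥ 1` and
`k₀ = l−1`, and `2k₁l` if `k₁ ≥ 1` and `0 ≤ k₀ ≤ l−2`. -/
def dimT (l k : ℕ) : ℤ :=
  if k / l = 0 then ((k % l : ℕ) : ℤ) + 1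
  else if k % l = l - 1 then (l : ℤ) * (((k / l : ℕ) : ℤ) + 1)
  else 2 * ((k / l : ℕ) : ℤ) * l


open Polynomial in
lemma l1_mul (n : ℕ) (p q : Polynomial ℝ) :
    ∑ i ∈ Finset.range n, |(p * q).coeff i| ≤
      (∑ i ∈ Finset.range n, |p.coeff i|) * (∑ i ∈ Finset.range n, |q.coeff i|) := by
  classical
  rw [Finset.sum_mul_sum, ← Finset.sum_product']
  set s := (Finset.range n ×ˢ Finset.range n).filter (fun x => x.1 + x.2 < n) with hs
  have h1 : ∑ x ∈ s, |p.coeff x.1| * |q.coeff x.2| ≤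
      ∑ x ∈ Finset.range n ×ˢ Finset.range n, |p.coeff x.1| * |q.coeff x.2| :=
    Finset.sum_le_sum_of_subset_of_nonneg (Finset.filter_subset _ _)
      (fun _ _ _ => by positivity)
  refine le_trans ?_ h1
  rw [← Finset.sum_fiberwise_of_maps_to (t := Finset.range n) (g := fun x : ℕ × ℕ => x.1 + x.2)
    (by intro x hx; simp [hs] at hx; simpa using hx.2)]
  refine Finset.sum_le_sum fun i hi => ?_
  rw [Polynomial.coeff_mul]
  refine (Finset.abs_sum_le_sum_abs _ _).trans (le_of_eq ?_)
  simp only [abs_mul]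
  refine Finset.sum_congr ?_ (fun _ _ => rfl)
  ext x
  have := Finset.mem_range.1 hi
  rw [Finset.HasAntidiagonal.mem_antidiagonal, hs, Finset.mem_filter, Finset.mem_filter, Finset.mem_product,
    Finset.mem_range, Finset.mem_range]
  omega

lemma variance_binom (n : ℕ) :
    ∑ i ∈ Finset.range (n + 1), (n.choose i : ℝ) * ((n : ℝ) - 2 * i) ^ 2 = (n : ℝ) * 2 ^ n := by
  have h := congrArg (Polynomial.eval (1 / 2 : ℝ)) (bernsteinPolynomial.variance ℝ n)
  simp only [Polynomial.eval_finsetSum, bernsteinPolynomial, Polynomial.eval_mul,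
    Polynomial.eval_pow, Polynomial.eval_sub, Polynomial.eval_X, Polynomial.eval_one,
    nsmul_eq_mul, Polynomial.eval_natCast] at h
  have h2 : ∀ i ∈ Finset.range (n + 1), (n.choose i : ℝ) * ((n : ℝ) - 2 * i) ^ 2 =
      4 * 2 ^ n * (((n : ℝ) * (1 / 2) - i) ^ 2 *
        ((n.choose i : ℝ) * (1 / 2) ^ i * (1 - 1 / 2) ^ (n - i))) := by
    intro i hi
    have hi' : i ≤ n := by simpa [Nat.lt_succ_iff] using hi
    have : (2 : ℝ) ^ n * ((1 / 2) ^ i * (1 - 1 / 2) ^ (n - i)) = 1 := by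
      rw [show (1 - 1 / 2 : ℝ) = 1 / 2 by norm_num, ← pow_add, Nat.add_sub_cancel' hi',
        ← mul_pow]; norm_num
    linear_combination (-(n.choose i : ℝ) * ((n : ℝ) - 2 * i) ^ 2) * this
  rw [Finset.sum_congr rfl h2, ← Finset.mul_sum, h]
  ring

open Polynomial in
lemma l1_one (n M : ℕ) :
    ∑ i ∈ Finset.range n, |((1 + X) ^ M * (1 - X) : ℝ[X]).coeff i| ≤
      2 ^ (M + 1) / Real.sqrt (M + 1) := by
  have hc : ∀ i, ((1 + X) ^ M * (1 - X) : ℝ[X]).coeff i =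
      ((M + 1).choose i : ℝ) * (((M + 1 : ℕ) : ℝ) - 2 * i) / (M + 1) := by
    intro i
    have hM : (M + 1 : ℝ) ≠ 0 := by positivity
    rw [eq_div_iff hM, mul_sub, mul_one, coeff_sub]
    cases i with
    | zero => simp [coeff_one_add_X_pow]
    | succ i =>
      rw [coeff_mul_X, coeff_one_add_X_pow, coeff_one_add_X_pow]
      have e1 : ((M + 1 : ℝ)) * M.choose i = (M + 1).choose (i + 1) * (i + 1) := by
        exact_mod_cast Nat.add_one_mul_choose_eq M i
      have e2 : ((M + 1).choose (i + 1) : ℝ) = M.choose i + M.choose (i + 1) := by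
        exact_mod_cast Nat.choose_succ_succ M i
      push_cast
      linear_combination (-2 : ℝ) * e1 - (M + 1) * e2
  simp only [hc]
  set m := M + 1 with hm
  have hmR : (M + 1 : ℝ) = m := by push_cast [hm]; ring
  rw [hmR]
  have hmpos : (0 : ℝ) < m := by rw [← hmR]; positivity
  have h1 : ∑ i ∈ Finset.range n, |(m.choose i : ℝ) * ((m : ℝ) - 2 * i) / m| ≤
      ∑ i ∈ Finset.range (m + 1), |(m.choose i : ℝ) * ((m : ℝ) - 2 * i) / m| := by
    have h2 : ∑ i ∈ Finset.range n, |(m.choose i : ℝ) * ((m : ℝ) - 2 * i) / m| ≤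
      ∑ i ∈ Finset.range (max n (m + 1)), |(m.choose i : ℝ) * ((m : ℝ) - 2 * i) / m| :=
      Finset.sum_le_sum_of_subset_of_nonneg (by intro x; simp; omega)
        (fun _ _ _ => abs_nonneg _)
    refine h2.trans (le_of_eq ?_)
    symm
    refine Finset.sum_subset (by intro x; simp; omega) ?_
    intro x _ hx
    have : m < x := by simpa using hx
    simp [Nat.choose_eq_zero_of_lt this]
  refine h1.trans ?_
  have hs : 0 < Real.sqrt m := Real.sqrt_pos.2 hmpos
  have hCS := Finset.sum_mul_sq_le_sq_mul_sq (Finset.range (m + 1))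
    (fun i => Real.sqrt (m.choose i)) (fun i => Real.sqrt (m.choose i) * |(m : ℝ) - 2 * i|)
  have e1 : ∀ i : ℕ, Real.sqrt (m.choose i) * (Real.sqrt (m.choose i) * |(m : ℝ) - 2 * i|) =
      (m.choose i : ℝ) * |(m : ℝ) - 2 * i| := by
    intro i
    rw [← mul_assoc, Real.mul_self_sqrt (by positivity)]
  have e2 : ∀ i : ℕ, (Real.sqrt (m.choose i) * |(m : ℝ) - 2 * i|) ^ 2 =
      (m.choose i : ℝ) * ((m : ℝ) - 2 * i) ^ 2 := by
    intro i
    rw [mul_pow, Real.sq_sqrt (by positivity), sq_abs]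
  have e3 : ∀ i : ℕ, Real.sqrt (m.choose i) ^ 2 = (m.choose i : ℝ) := fun i =>
    Real.sq_sqrt (by positivity)
  have e4 : ∑ i ∈ Finset.range (m + 1), (m.choose i : ℝ) = 2 ^ m := by
    exact_mod_cast Nat.sum_range_choose m
  simp only [e1, e2, e3, e4, variance_binom] at hCS
  have h5 : ∑ i ∈ Finset.range (m + 1), (m.choose i : ℝ) * |(m : ℝ) - 2 * i| ≤
      2 ^ m * Real.sqrt m := by
    refine abs_le_of_sq_le_sq' ?_ (by positivity) |>.2
    rw [mul_pow, Real.sq_sqrt hmpos.le]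
    linarith
  have h6 : ∑ i ∈ Finset.range (m + 1), |(m.choose i : ℝ) * ((m : ℝ) - 2 * i) / m| =
      (∑ i ∈ Finset.range (m + 1), (m.choose i : ℝ) * |(m : ℝ) - 2 * i|) / m := by
    rw [Finset.sum_div]
    refine Finset.sum_congr rfl fun i _ => ?_
    rw [abs_div, abs_mul, Nat.abs_cast, Nat.abs_cast]
  rw [h6, div_le_div_iff₀ hmpos hs]
  calc _ ≤ 2 ^ m * Real.sqrt m * Real.sqrt m := by gcongr
    _ = _ := by rw [mul_assoc, Real.mul_self_sqrt hmpos.le]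

open Polynomial in
lemma l1_three (n N : ℕ) :
    ∑ i ∈ Finset.range n, |((1 + X) ^ N * (1 - X) ^ 3 : ℝ[X]).coeff i| ≤
      64 * 2 ^ N / Real.sqrt (N + 1) ^ 3 := by
  obtain ⟨M, e, hN, he⟩ : ∃ M e, N = e + 3 * M ∧ e < 3 := ⟨N / 3, N % 3, by omega, by omega⟩
  set q : ℝ[X] := (1 + X) ^ M * (1 - X) with hq
  have hp : ((1 + X) ^ N * (1 - X) ^ 3 : ℝ[X]) = (1 + X) ^ e * (q * (q * q)) := by
    rw [hN, hq]; ring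
  rw [hp]
  have h0 : ∑ i ∈ Finset.range n, |((1 + X) ^ e : ℝ[X]).coeff i| ≤ 2 ^ e := by
    simp only [coeff_one_add_X_pow, Nat.abs_cast]
    have h2 : ∑ i ∈ Finset.range n, (e.choose i : ℝ) ≤
        ∑ i ∈ Finset.range (max n (e + 1)), (e.choose i : ℝ) :=
      Finset.sum_le_sum_of_subset_of_nonneg (by intro x; simp; omega)
        (fun _ _ _ => by positivity)
    refine h2.trans (le_of_eq ?_)
    have e4 : ∑ i ∈ Finset.range (e + 1), (e.choose i : ℝ) = 2 ^ e := by
      exact_mod_cast Nat.sum_range_choose e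
    rw [← e4]
    symm
    refine Finset.sum_subset (by intro x; simp; omega) ?_
    intro x _ hx
    have : e < x := by simpa using hx
    simp [Nat.choose_eq_zero_of_lt this]
  have h1 := l1_one n M
  rw [← hq] at h1
  set Q := ∑ i ∈ Finset.range n, |q.coeff i| with hQ
  have hQ0 : 0 ≤ Q := Finset.sum_nonneg fun _ _ => abs_nonneg _
  set B : ℝ := 2 ^ (M + 1) / Real.sqrt (M + 1) with hB
  have hs : 0 < Real.sqrt (M + 1 : ℝ) := Real.sqrt_pos.2 (by positivity)
  have hB0 : 0 ≤ B := by positivity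
  have h3 : ∑ i ∈ Finset.range n, |((1 + X) ^ e * (q * (q * q)) : ℝ[X]).coeff i| ≤
      2 ^ e * (B * (B * B)) := by
    refine (l1_mul _ _ _).trans ?_
    gcongr
    refine (l1_mul _ _ _).trans ?_
    gcongr
    refine (l1_mul _ _ _).trans ?_
    gcongr
  refine h3.trans ?_
  have hs2 : Real.sqrt (N + 1 : ℝ) ≤ 2 * Real.sqrt (M + 1) := by
    rw [Real.sqrt_le_left (by positivity), mul_pow, Real.sq_sqrt (by positivity)]
    have : N + 1 ≤ 4 * (M + 1) := by omega
    calc (N + 1 : ℝ) ≤ 4 * (M + 1) := by exact_mod_cast this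
      _ = _ := by norm_num
  have hsN : 0 < Real.sqrt (N + 1 : ℝ) := Real.sqrt_pos.2 (by positivity)
  have hs3 : Real.sqrt (N + 1 : ℝ) ^ 3 ≤ (2 * Real.sqrt (M + 1)) ^ 3 := by gcongr
  have hE : (2 : ℝ) ^ e * (B * (B * B)) = 8 * 2 ^ N / Real.sqrt (M + 1) ^ 3 := by
    rw [hB, hN]; field_simp; ring
  rw [hE, div_le_div_iff₀ (by positivity) (by positivity)]
  calc 8 * 2 ^ N * Real.sqrt (N + 1 : ℝ) ^ 3 ≤ 8 * 2 ^ N * (2 * Real.sqrt (M + 1)) ^ 3 := by gcongr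
    _ = _ := by ring

/-- Comparison of the alternating sum with its mean. -/
lemma seq_compare (a : ℕ → ℝ) (l r N : ℕ) (hr : r ≤ l)
    (ha : a (l * (N + 1)) = 0) (C : ℝ)
    (hC : ∑ m ∈ Finset.range (l * (N + 1)), |a m - 2 * a (m + 1) + a (m + 2)| ≤ C) :
    |(l : ℝ) * (∑ j ∈ Finset.range (N + 1), (a (l * j) - a (l * j + r))) - r * a 0| ≤
      2 * l * l * C := by
  set c : ℕ → ℝ := fun m => |a m - 2 * a (m + 1) + a (m + 2)| with hc
  set V : ℕ → ℝ := fun j => ∑ i ∈ Finset.range l, c (l * j + i) with hV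
  have hVsum : ∀ K, ∑ j ∈ Finset.range K, V j = ∑ m ∈ Finset.range (l * K), c m := by
    intro K
    induction K with
    | zero => simp
    | succ K ih => rw [Finset.sum_range_succ, ih, Nat.mul_succ, Finset.sum_range_add]
  have hV0 : ∀ j, 0 ≤ V j := fun j => Finset.sum_nonneg fun _ _ => abs_nonneg _
  have htel : ∀ K, ∑ j ∈ Finset.range K, (a (l * j) - a (l * j + l)) = a 0 - a (l * K) := by
    intro K
    have := Finset.sum_range_sub' (fun j => a (l * j)) K
    simpa [Nat.mul_succ] using this
  have ha0 : a 0 = ∑ j ∈ Finset.range (N + 1), (a (l * j) - a (l * j + l)) := by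
    rw [htel, ha, sub_zero]
  -- first differences inside a block
  have hb : ∀ j i, i ≤ l → |(a (l * j + i) - a (l * j + i + 1)) - (a (l * j) - a (l * j + 1))| ≤
      V j := by
    intro j i hi
    have h1 : ∀ i, |(a (l * j + i) - a (l * j + i + 1)) - (a (l * j) - a (l * j + 1))| ≤
        ∑ q ∈ Finset.range i, c (l * j + q) := by
      intro i
      induction i with
      | zero => simp
      | succ i ih =>
        rw [Finset.sum_range_succ]
        have : (a (l * j + (i + 1)) - a (l * j + (i + 1) + 1)) - (a (l * j) - a (l * j + 1)) =
          ((a (l * j + i) - a (l * j + i + 1)) - (a (l * j) - a (l * j + 1))) -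
            (a (l * j + i) - 2 * a (l * j + i + 1) + a (l * j + i + 2)) := by
          rw [show l * j + (i + 1) = l * j + i + 1 by ring]; ring
        rw [this]
        exact (abs_sub _ _).trans (add_le_add ih le_rfl)
    refine (h1 i).trans ?_
    exact Finset.sum_le_sum_of_subset_of_nonneg (Finset.range_mono hi)
      (fun _ _ _ => abs_nonneg _)
  have hd : ∀ j i, i ≤ l → |(a (l * j) - a (l * j + i)) - i * (a (l * j) - a (l * j + 1))| ≤
      i * V j := by
    intro j i
    induction i with
    | zero => intro _; simp
    | succ i ih =>
      intro hi
      have : (a (l * j) - a (l * j + (i + 1))) - ((i + 1 : ℕ) : ℝ) * (a (l * j) - a (l * j + 1)) =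
        ((a (l * j) - a (l * j + i)) - i * (a (l * j) - a (l * j + 1))) +
        ((a (l * j + i) - a (l * j + i + 1)) - (a (l * j) - a (l * j + 1))) := by
        rw [show l * j + (i + 1) = l * j + i + 1 by ring]; push_cast; ring
      rw [this]
      refine (abs_add_le _ _).trans ?_
      have := hb j i (by omega)
      have := ih (by omega)
      push_cast
      linarith
  have hrl : (r : ℝ) ≤ l := by exact_mod_cast hr
  have hblock : ∀ j, |(l : ℝ) * (a (l * j) - a (l * j + r)) - r * (a (l * j) - a (l * j + l))| ≤
      2 * l * l * V j := by
    intro j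
    have e : (l : ℝ) * (a (l * j) - a (l * j + r)) - r * (a (l * j) - a (l * j + l)) =
      l * ((a (l * j) - a (l * j + r)) - r * (a (l * j) - a (l * j + 1))) -
      r * ((a (l * j) - a (l * j + l)) - l * (a (l * j) - a (l * j + 1))) := by ring
    rw [e]
    refine (abs_sub _ _).trans ?_
    rw [abs_mul, abs_mul, Nat.abs_cast, Nat.abs_cast]
    have h1 := mul_le_mul_of_nonneg_left (hd j r hr) (Nat.cast_nonneg (α := ℝ) l)
    have h2 := mul_le_mul_of_nonneg_left (hd j l le_rfl) (Nat.cast_nonneg (α := ℝ) r)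
    have h3 : (r : ℝ) * (l * V j) ≤ l * (l * V j) :=
      mul_le_mul_of_nonneg_right hrl (mul_nonneg (Nat.cast_nonneg _) (hV0 j))
    nlinarith
  have e : (l : ℝ) * (∑ j ∈ Finset.range (N + 1), (a (l * j) - a (l * j + r))) - r * a 0 =
      ∑ j ∈ Finset.range (N + 1),
        ((l : ℝ) * (a (l * j) - a (l * j + r)) - r * (a (l * j) - a (l * j + l))) := by
    conv_rhs => rw [Finset.sum_sub_distrib, ← Finset.mul_sum, ← Finset.mul_sum, ← ha0]
  rw [e]
  refine (Finset.abs_sum_le_sum_abs _ _).trans ?_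
  refine (Finset.sum_le_sum fun j _ => hblock j).trans ?_
  rw [← Finset.mul_sum, hVsum]
  gcongr

lemma phi_bound (x : ℝ) (hx : |x| ≤ 1 / 2) :
    |((1 - x) * Real.log (1 - x) + (1 + x) * Real.log (1 + x)) - x ^ 2| ≤ 6 * |x| ^ 3 := by
  have key : ∀ y : ℝ, |y| ≤ 1 / 2 → |y + y ^ 2 / 2 + Real.log (1 - y)| ≤ 2 * |y| ^ 3 := by
    intro y hy
    have h := Real.abs_log_sub_add_sum_range_le (x := y) (by linarith) 2
    simp [Finset.sum_range_succ] at h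
    norm_num at h
    refine h.trans ?_
    rw [div_le_iff₀ (by linarith)]
    nlinarith [pow_nonneg (abs_nonneg y) 3]
  have h1 := key x hx
  have h2 := key (-x) (by rwa [abs_neg])
  rw [abs_neg, sub_neg_eq_add] at h2
  have e : ((1 - x) * Real.log (1 - x) + (1 + x) * Real.log (1 + x)) - x ^ 2 =
    (1 - x) * (x + x ^ 2 / 2 + Real.log (1 - x)) +
    (1 + x) * (-x + (-x) ^ 2 / 2 + Real.log (1 + x)) := by ring
  rw [e]
  refine (abs_add_le _ _).trans ?_
  rw [abs_mul, abs_mul]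
  have hx' := abs_le.1 hx
  rw [abs_of_nonneg (by linarith : 0 ≤ 1 - x), abs_of_nonneg (by linarith : 0 ≤ 1 + x)]
  nlinarith [mul_le_mul_of_nonneg_left h1 (by linarith : 0 ≤ 1 - x),
    mul_le_mul_of_nonneg_left h2 (by linarith : 0 ≤ 1 + x), pow_nonneg (abs_nonneg x) 3]

lemma llt_identity (t s : ℕ) (ht : 0 < t) (hs : 0 < s) :
    ((t + s).choose t : ℝ) * Real.sqrt ((t : ℝ) + s) / 2 ^ (t + s) =
      Stirling.stirlingSeq (t + s) / (Stirling.stirlingSeq t * Stirling.stirlingSeq s) *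
      (1 / Real.sqrt (2 * ((t : ℝ) / (t + s)) * ((s : ℝ) / (t + s)))) *
      Real.exp (-(((t : ℝ) + s) / 2 *
        ((1 - ((s : ℝ) - t) / (t + s)) * Real.log (1 - ((s : ℝ) - t) / (t + s)) +
         (1 + ((s : ℝ) - t) / (t + s)) * Real.log (1 + ((s : ℝ) - t) / (t + s))))) := by
  have ht' : (0 : ℝ) < t := by exact_mod_cast ht
  have hs' : (0 : ℝ) < s := by exact_mod_cast hs
  have e1 : 1 - ((s : ℝ) - t) / (t + s) = 2 * t / (t + s) := by field_simp; ring
  have e2 : 1 + ((s : ℝ) - t) / (t + s) = 2 * s / (t + s) := by field_simp; ring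
  rw [e1, e2]
  have e3 : Real.exp (-(((t : ℝ) + s) / 2 *
        (2 * t / (t + s) * Real.log (2 * t / (t + s)) +
         2 * s / (t + s) * Real.log (2 * s / (t + s))))) =
      ((t : ℝ) + s) ^ (t + s) / (2 ^ (t + s) * (t : ℝ) ^ t * (s : ℝ) ^ s) := by
    have : -(((t : ℝ) + s) / 2 *
        (2 * t / (t + s) * Real.log (2 * t / (t + s)) +
         2 * s / (t + s) * Real.log (2 * s / (t + s)))) =
         -(t * Real.log (2 * t / (t + s))  + s * Real.log (2 * s / (t + s))) := by
      field_simp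
    rw [this, Real.exp_neg, Real.exp_add, mul_comm (t : ℝ), mul_comm (s : ℝ), Real.exp_mul,
      Real.exp_mul, Real.exp_log (by positivity), Real.exp_log (by positivity),
      Real.rpow_natCast, Real.rpow_natCast, div_pow, div_pow, mul_pow, mul_pow, pow_add, pow_add]
    field_simp
  rw [e3]
  have e4 : Real.sqrt (2 * ((t : ℝ) / (t + s)) * ((s : ℝ) / (t + s))) =
      Real.sqrt 2 * Real.sqrt t * Real.sqrt s / (t + s) := by
    rw [show 2 * ((t : ℝ) / (t + s)) * ((s : ℝ) / (t + s)) = 2 * t * s / (t + s) ^ 2 by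
      field_simp, Real.sqrt_div (by positivity), Real.sqrt_sq (by positivity),
      Real.sqrt_mul (by positivity), Real.sqrt_mul (by positivity)]
  rw [e4]
  have hch : ((t + s).choose t : ℝ) = ((t + s).factorial : ℝ) / (t.factorial * s.factorial) := by
    rw [Nat.cast_add_choose]
  rw [hch]
  simp only [Stirling.stirlingSeq]
  push_cast
  rw [Real.sqrt_mul (by positivity) (t : ℝ), Real.sqrt_mul (by positivity) (s : ℝ),
    Real.sqrt_mul (by positivity) ((t : ℝ) + s), div_pow, div_pow, div_pow]
  have h2 : 0 < Real.sqrt 2 := by positivity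
  have h3 : 0 < Real.sqrt ((t : ℝ) + s) := Real.sqrt_pos.2 (by positivity)
  have h4 : 0 < Real.sqrt (t : ℝ) := Real.sqrt_pos.2 ht'
  have h5 : 0 < Real.sqrt (s : ℝ) := Real.sqrt_pos.2 hs'
  have h6 : Real.sqrt ((t : ℝ) + s) ^ 2 = t + s := Real.sq_sqrt (by positivity)
  have h7 : 0 < Real.exp 1 := Real.exp_pos 1
  rw [pow_add (Real.exp 1)]
  field_simp
  rw [h6]

lemma llt (t s : ℕ → ℕ) (c : ℝ) (hN : Tendsto (fun n => (t n : ℝ) + s n) atTop atTop)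
    (h : Tendsto (fun n => ((s n : ℝ) - t n) / Real.sqrt ((t n : ℝ) + s n)) atTop (nhds c)) :
    Tendsto (fun n => ((t n + s n).choose (t n) : ℝ) * Real.sqrt ((t n : ℝ) + s n) /
      2 ^ (t n + s n)) atTop (nhds (Real.sqrt (2 / π) * Real.exp (-(c ^ 2 / 2)))) := by
  have hpos : ∀ᶠ n in atTop, (0 : ℝ) < (t n : ℝ) + s n := hN.eventually_gt_atTop 0
  have hsq : Tendsto (fun n => Real.sqrt ((t n : ℝ) + s n)) atTop atTop :=
    Real.tendsto_sqrt_atTop.comp hN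
  set x : ℕ → ℝ := fun n => ((s n : ℝ) - t n) / ((t n : ℝ) + s n) with hx
  have hx0 : Tendsto x atTop (nhds 0) := by
    have := h.mul hsq.inv_tendsto_atTop
    rw [mul_zero] at this
    refine this.congr' ?_
    filter_upwards [hpos] with n hn
    simp only [hx, Pi.inv_apply]
    have h3 : 0 < Real.sqrt ((t n : ℝ) + s n) := Real.sqrt_pos.2 hn
    have h6 : Real.sqrt ((t n : ℝ) + s n) ^ 2 = t n + s n := Real.sq_sqrt hn.le
    rw [← h6]
    simp only [Real.sqrt_sq h3.le]
    field_simp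
  have hNx : Tendsto (fun n => ((t n : ℝ) + s n) * x n ^ 2) atTop (nhds (c ^ 2)) := by
    refine (h.pow 2).congr' ?_
    filter_upwards [hpos] with n hn
    simp only [hx]
    rw [div_pow, Real.sq_sqrt hn.le]
    field_simp
  have htN : Tendsto (fun n => (t n : ℝ) / (t n + s n)) atTop (nhds (1 / 2)) := by
    have : Tendsto (fun n => (1 - x n) / 2) atTop (nhds ((1 - 0) / 2)) :=
      (tendsto_const_nhds.sub hx0).div_const 2
    rw [sub_zero] at this
    refine this.congr' ?_
    filter_upwards [hpos] with n hn
    simp only [hx]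
    field_simp
    ring
  have hsN : Tendsto (fun n => (s n : ℝ) / (t n + s n)) atTop (nhds (1 / 2)) := by
    have : Tendsto (fun n => (1 + x n) / 2) atTop (nhds ((1 + 0) / 2)) :=
      (tendsto_const_nhds.add hx0).div_const 2
    rw [add_zero] at this
    refine this.congr' ?_
    filter_upwards [hpos] with n hn
    simp only [hx]
    field_simp
    ring
  have ht : Tendsto t atTop atTop := by
    rw [← tendsto_natCast_atTop_iff (R := ℝ)]
    refine (htN.pos_mul_atTop (by norm_num) hN).congr' ?_
    filter_upwards [hpos] with n hn
    field_simp
  have hs : Tendsto s atTop atTop := by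
    rw [← tendsto_natCast_atTop_iff (R := ℝ)]
    refine (hsN.pos_mul_atTop (by norm_num) hN).congr' ?_
    filter_upwards [hpos] with n hn
    field_simp
  have hts : Tendsto (fun n => t n + s n) atTop atTop := by
    rw [← tendsto_natCast_atTop_iff (R := ℝ)]
    simpa using hN
  set φ : ℕ → ℝ := fun n => (1 - x n) * Real.log (1 - x n) + (1 + x n) * Real.log (1 + x n)
    with hφ
  have hφl : Tendsto (fun n => ((t n : ℝ) + s n) / 2 * φ n) atTop (nhds (c ^ 2 / 2)) := by
    have hdiff : Tendsto (fun n => ((t n : ℝ) + s n) / 2 * (φ n - x n ^ 2)) atTop (nhds 0) := by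
      have hb : Tendsto (fun n => 3 * (((t n : ℝ) + s n) * x n ^ 2) * |x n|) atTop
          (nhds (3 * c ^ 2 * |0|)) := (hNx.const_mul 3).mul hx0.abs
      rw [abs_zero, mul_zero] at hb
      refine squeeze_zero_norm' ?_ hb
      have hsm : ∀ᶠ n in atTop, |x n| < 1 / 2 := by
        have := hx0.abs
        rw [abs_zero] at this
        exact this.eventually_lt_const (by norm_num)
      filter_upwards [hpos, hsm] with n hn hxn
      rw [Real.norm_eq_abs, abs_mul, abs_of_nonneg (by linarith : 0 ≤ ((t n : ℝ) + s n) / 2)]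
      have := phi_bound (x n) hxn.le
      calc _ ≤ ((t n : ℝ) + s n) / 2 * (6 * |x n| ^ 3) := by
            exact mul_le_mul_of_nonneg_left this (by linarith)
        _ = _ := by rw [← sq_abs (x n)]; ring
    have := hdiff.add (hNx.div_const 2)
    rw [zero_add] at this
    refine this.congr fun n => ?_
    ring
  have hexp := (Real.continuous_exp.tendsto _).comp hφl.neg
  have hst : Tendsto (fun n => Stirling.stirlingSeq (t n + s n) /
      (Stirling.stirlingSeq (t n) * Stirling.stirlingSeq (s n))) atTop
      (nhds (Real.sqrt π / (Real.sqrt π * Real.sqrt π))) :=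
    (Stirling.tendsto_stirlingSeq_sqrt_pi.comp hts).div
      ((Stirling.tendsto_stirlingSeq_sqrt_pi.comp ht).mul
        (Stirling.tendsto_stirlingSeq_sqrt_pi.comp hs)) (by positivity)
  have hsr : Tendsto (fun n => 1 / Real.sqrt (2 * ((t n : ℝ) / (t n + s n)) *
      ((s n : ℝ) / (t n + s n)))) atTop (nhds (1 / Real.sqrt (2 * (1 / 2) * (1 / 2)))) := by
    refine tendsto_const_nhds.div ?_ (by positivity)
    exact (Real.continuous_sqrt.tendsto _).comp ((htN.const_mul 2).mul hsN)
  have hall := (hst.mul hsr).mul hexp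
  have hconst : Real.sqrt π / (Real.sqrt π * Real.sqrt π) * (1 / Real.sqrt (2 * (1 / 2) * (1 / 2)))
      = Real.sqrt (2 / π) := by
    rw [show (2 * (1 / 2) * (1 / 2) : ℝ) = 1 / 2 by norm_num, Real.sqrt_div (by norm_num),
      Real.sqrt_div (by norm_num), Real.sqrt_one]
    have : 0 < Real.sqrt π := by positivity
    field_simp
  rw [hconst] at hall
  refine hall.congr' ?_
  filter_upwards [ht.eventually_gt_atTop 0, hs.eventually_gt_atTop 0] with n h1 h2
  rw [llt_identity _ _ h1 h2]
  rfl

lemma rep_step (p : Polynomial ℝ) (u : ℤ → ℝ)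
    (h : (∀ i : ℕ, p.coeff i = u i) ∧ ∀ i : ℤ, i < 0 → u i = 0) :
    (∀ i : ℕ, (p * (1 - Polynomial.X)).coeff i = u i - u (i - 1)) ∧
      ∀ i : ℤ, i < 0 → u i - u (i - 1) = 0 := by
  refine ⟨fun i => ?_, fun i hi => ?_⟩
  · rw [mul_sub, mul_one, Polynomial.coeff_sub]
    cases i with
    | zero => simp [h.1, h.2 (-1) (by norm_num)]
    | succ i => rw [Polynomial.coeff_mul_X, h.1, h.1]; simp
  · rw [h.2 i hi, h.2 (i - 1) (by omega), sub_zero]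

lemma intBinom_nat (N i : ℕ) : intBinom N i = N.choose i := by
  unfold intBinom
  split_ifs with h
  · simp
  · rw [Nat.choose_eq_zero_of_lt (by omega)]; simp

lemma intBinom_neg (N : ℕ) (i : ℤ) (hi : i < 0) : intBinom N i = 0 := by
  unfold intBinom
  rw [if_neg (by omega)]

lemma Fcoef_eq (N : ℕ) (k t : ℤ) (h : k + 2 * t = N) :
    Fcoef N k = intBinom N t - intBinom N (t - 1) := by
  unfold Fcoef
  rw [if_pos (by omega), show ((N : ℤ) - k) / 2 = t by omega,
    show ((N : ℤ) - k - 2) / 2 = t - 1 by omega]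

lemma Fcoef_mul (N k t : ℕ) (h : k + 2 * t = N) :
    (Fcoef N k : ℝ) * ((t : ℝ) + k + 1) = (N.choose t : ℝ) * (k + 1) := by
  rw [Fcoef_eq N k t (by exact_mod_cast h)]
  cases t with
  | zero =>
    rw [intBinom_neg N (((0 : ℕ) : ℤ) - 1) (by norm_num), intBinom_nat]
    simp
  | succ t =>
    rw [show (((t + 1 : ℕ) : ℤ) - 1) = (t : ℤ) by push_cast; ring, intBinom_nat, intBinom_nat]
    have h1 := Nat.choose_succ_right_eq N t
    rw [show N - t = t + k + 2 by omega] at h1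
    have h2 : (N.choose (t + 1) : ℝ) * (t + 1) = N.choose t * (t + k + 2) := by exact_mod_cast h1
    push_cast
    linear_combination h2

lemma sum_reflect_le (w : ℤ → ℝ) (hw : ∀ i : ℤ, i < 0 → w i = 0) (t K : ℕ) :
    ∑ m ∈ Finset.range K, |w ((t : ℤ) - m)| ≤ ∑ i ∈ Finset.range (t + 1), |w i| := by
  have h2 : ∑ m ∈ Finset.range K, |w ((t : ℤ) - m)| ≤
      ∑ m ∈ Finset.range (max K (t + 1)), |w ((t : ℤ) - m)| :=
    Finset.sum_le_sum_of_subset_of_nonneg (by intro x; simp; omega)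
      (fun _ _ _ => abs_nonneg _)
  refine h2.trans (le_of_eq ?_)
  have h3 : ∑ m ∈ Finset.range (t + 1), |w ((t : ℤ) - m)| =
      ∑ m ∈ Finset.range (max K (t + 1)), |w ((t : ℤ) - m)| := by
    refine Finset.sum_subset (by intro x; simp; omega) ?_
    intro x _ hx
    have : t < x := by simpa using hx
    rw [hw _ (by omega), abs_zero]
  rw [← h3, ← Finset.sum_range_reflect]
  refine Finset.sum_congr rfl fun i hi => ?_
  have : i < t + 1 := Finset.mem_range.1 hi
  congr 2
  omega

lemma M_err (N k l r t : ℕ) (h : k + 2 * t = N) (hl : 1 ≤ l) (hr : r ≤ l) :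
    |(l : ℝ) * (∑ j ∈ Finset.range (N + 1), ((Fcoef N ((k : ℤ) + 2 * ((l * j : ℕ) : ℤ)) : ℝ) -
        (Fcoef N ((k : ℤ) + 2 * ((l * j + r : ℕ) : ℤ)) : ℝ))) - r * (Fcoef N k : ℝ)| ≤
      2 * l * l * (64 * 2 ^ N / Real.sqrt (N + 1) ^ 3) := by
  set a : ℕ → ℝ := fun m => (Fcoef N ((k : ℤ) + 2 * (m : ℤ)) : ℝ) with ha
  set B : ℤ → ℝ := fun i => (intBinom N i : ℝ) with hB
  have haB : ∀ m : ℕ, a m = B ((t : ℤ) - m) - B ((t : ℤ) - m - 1) := by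
    intro m
    simp only [ha, hB]
    rw [Fcoef_eq N _ ((t : ℤ) - m) (by omega)]
    push_cast
    rfl
  have hrep0 : (∀ i : ℕ, ((1 + Polynomial.X) ^ N : Polynomial ℝ).coeff i = B i) ∧
      ∀ i : ℤ, i < 0 → B i = 0 := by
    refine ⟨fun i => ?_, fun i hi => ?_⟩
    · rw [Polynomial.coeff_one_add_X_pow]; simp [hB, intBinom_nat]
    · simp [hB, intBinom_neg N i hi]
  have hrep := rep_step _ (fun i => B i - B (i - 1) - (B (i - 1) - B (i - 1 - 1)))
    (rep_step _ (fun i => B i - B (i - 1)) (rep_step _ _ hrep0))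
  set w : ℤ → ℝ := fun i => B i - B (i - 1) - (B (i - 1) - B (i - 1 - 1)) -
    (B (i - 1) - B (i - 1 - 1) - (B (i - 1 - 1) - B (i - 1 - 1 - 1))) with hw
  have h0 : a 0 = (Fcoef N k : ℝ) := by simp [ha]
  rw [← h0]
  refine seq_compare a l r N hr ?_ _ ?_
  · rw [haB]
    have : ((t : ℤ) - (l * (N + 1) : ℕ)) < 0 := by
      have : N + 1 ≤ l * (N + 1) := Nat.le_mul_of_pos_left _ hl
      omega
    rw [hrep0.2 _ this, hrep0.2 _ (by omega), sub_zero]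
  · have e : ∀ m : ℕ, |a m - 2 * a (m + 1) + a (m + 2)| = |w ((t : ℤ) - m)| := by
      intro m
      rw [haB, haB, haB]
      simp only [hw]
      congr 1
      push_cast
      rw [show (t : ℤ) - (m + 1) = t - m - 1 by ring, show (t : ℤ) - (m + 2) = t - m - 1 - 1 by ring]
      ring
    simp only [e]
    refine (sum_reflect_le w hrep.2 t _).trans ?_
    refine le_trans (le_of_eq ?_) (l1_three (t + 1) N)
    refine Finset.sum_congr rfl fun i _ => ?_
    have := hrep.1 i
    rw [show ((1 + Polynomial.X) ^ N * (1 - Polynomial.X) ^ 3 : Polynomial ℝ) =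
      (1 + Polynomial.X) ^ N * (1 - Polynomial.X) * (1 - Polynomial.X) * (1 - Polynomial.X) by ring,
      this]

lemma Mmult_err (N l k₁ k₀ t : ℕ) (h : k₁ * l + k₀ + 2 * t = N) (hk : k₀ < l - 1) :
    |(l : ℝ) * (Mmult l (k₁ * l + k₀) N : ℝ) -
      ((l : ℝ) - 1 - k₀) * (Fcoef N ((k₁ * l + k₀ : ℕ) : ℤ) : ℝ)| ≤
      2 * l * l * (64 * 2 ^ N / Real.sqrt (N + 1) ^ 3) := by
  have h1 := M_err N (k₁ * l + k₀) l (l - 1 - k₀) t h (by omega) (by omega)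
  have hmod : (k₁ * l + k₀) % l = k₀ := by
    rw [Nat.mul_comm, Nat.mul_add_mod]; exact Nat.mod_eq_of_lt (by omega)
  have hdiv : (k₁ * l + k₀) / l = k₁ := by
    rw [Nat.mul_comm, Nat.mul_add_div (by omega), Nat.div_eq_of_lt (by omega), add_zero]
  have hr : ((l - 1 - k₀ : ℕ) : ℝ) = (l : ℝ) - 1 - k₀ := by
    rw [Nat.cast_sub (by omega), Nat.cast_sub (by omega)]; simp
  have hrZ : ((l - 1 - k₀ : ℕ) : ℤ) = (l : ℤ) - 1 - k₀ := by omega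
  rw [hr] at h1
  convert h1 using 5
  unfold Mmult
  rw [hmod, hdiv, if_neg (by omega)]
  push_cast
  refine Finset.sum_congr rfl fun j _ => ?_
  rw [hrZ]
  congr 3 <;> ring_nf

lemma main_F (l N₀ k₀ : ℕ) (hl : Odd l) (hl3 : 3 ≤ l) (α : ℝ)
    (k₁ : ℕ → ℕ) (hpar : ∀ n, k₁ n % 2 = (N₀ + k₀) % 2)
    (hconv : Tendsto (fun n : ℕ => (k₁ n : ℝ) / Real.sqrt (2 * n)) atTop (nhds α)) :
    (∀ᶠ n in atTop, ∃ t, k₁ n * l + k₀ + 2 * t = 2 * l * n + N₀) ∧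
    Tendsto (fun n : ℕ => (n : ℝ) * ((Fcoef (2 * l * n + N₀) ((k₁ n * l + k₀ : ℕ) : ℤ) : ℝ) /
      2 ^ (2 * l * n + N₀))) atTop
      (nhds (Real.sqrt (2 / π) * Real.exp (-(α ^ 2 * l / 2)) * (α * Real.sqrt l) * (1 / l))) := by
  have hlpos : (0 : ℝ) < l := by exact_mod_cast (by omega : 0 < l)
  set N : ℕ → ℕ := fun n => 2 * l * n + N₀ with hN
  set k : ℕ → ℕ := fun n => k₁ n * l + k₀ with hk
  have hNn : Tendsto (fun n : ℕ => (N n : ℝ) / n) atTop (nhds (2 * l)) := by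
    have : Tendsto (fun n : ℕ => (2 * l : ℝ) + N₀ / (n : ℝ)) atTop (nhds (2 * l + 0)) :=
      tendsto_const_nhds.add (tendsto_const_div_atTop_nhds_zero_nat _)
    rw [add_zero] at this
    refine this.congr' ?_
    filter_upwards [eventually_gt_atTop 0] with n hn
    have : (0 : ℝ) < n := by exact_mod_cast hn
    simp only [hN]; push_cast; field_simp
  have hNat : Tendsto (fun n => (N n : ℝ)) atTop atTop := by
    refine (hNn.pos_mul_atTop (by positivity) tendsto_natCast_atTop_atTop).congr' ?_
    filter_upwards [eventually_gt_atTop 0] with n hn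
    have : (0 : ℝ) < n := by exact_mod_cast hn
    field_simp
  have hsqN : Tendsto (fun n => Real.sqrt (N n)) atTop atTop := Real.tendsto_sqrt_atTop.comp hNat
  have hratio : Tendsto (fun n : ℕ => Real.sqrt (2 * n) / Real.sqrt (N n)) atTop
      (nhds (1 / Real.sqrt l)) := by
    have h1 : Tendsto (fun n : ℕ => Real.sqrt (2 / ((N n : ℝ) / n))) atTop
        (nhds (Real.sqrt (2 / (2 * l)))) :=
      (Real.continuous_sqrt.tendsto _).comp (tendsto_const_nhds.div hNn (by positivity))
    rw [show (2 / (2 * l) : ℝ) = 1 / l by field_simp, Real.sqrt_div zero_le_one, Real.sqrt_one] at h1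
    refine h1.congr' ?_
    filter_upwards [eventually_gt_atTop 0] with n hn
    rw [← Real.sqrt_div (by positivity)]
    congr 1
    rw [div_div_eq_mul_div]
  have hkN : ∀ e : ℝ, Tendsto (fun n => ((k n : ℝ) + e) / Real.sqrt (N n)) atTop
      (nhds (α * Real.sqrt l)) := by
    intro e
    have h1 := ((hconv.mul hratio).mul_const (l : ℝ)).add (hsqN.inv_tendsto_atTop.const_mul (k₀ + e))
    rw [mul_zero, add_zero, show α * (1 / Real.sqrt l) * l = α * Real.sqrt l by
      have := Real.sq_sqrt hlpos.le
      have h3 := Real.sqrt_pos.2 hlpos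
      field_simp
      rw [this]] at h1
    refine h1.congr' ?_
    filter_upwards [eventually_gt_atTop 0, hNat.eventually_gt_atTop 0] with n hn hNp
    have : (0 : ℝ) < n := by exact_mod_cast hn
    have h2 : 0 < Real.sqrt (2 * n : ℝ) := Real.sqrt_pos.2 (by positivity)
    have h3 : 0 < Real.sqrt (N n : ℝ) := Real.sqrt_pos.2 hNp
    simp only [hk, Pi.inv_apply]
    push_cast
    field_simp
    ring
  have hkN1 : Tendsto (fun n => (k n : ℝ) / N n) atTop (nhds 0) := by
    have h1 := (hkN 0).mul hsqN.inv_tendsto_atTop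
    rw [mul_zero] at h1
    refine h1.congr' ?_
    filter_upwards [hNat.eventually_gt_atTop 0] with n hNp
    have h4 : Real.sqrt (N n : ℝ) * Real.sqrt (N n) = N n := Real.mul_self_sqrt hNp.le
    rw [Pi.inv_apply, add_zero, ← div_eq_mul_inv, div_div, h4]
  have hle : ∀ᶠ n in atTop, k n ≤ N n := by
    filter_upwards [hkN1.eventually_lt_const one_pos, hNat.eventually_gt_atTop 0] with n h1 h2
    rw [div_lt_one h2] at h1
    exact_mod_cast h1.le
  have hparity : ∀ n, k n % 2 = N n % 2 := by
    intro n
    have h1 := hpar n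
    obtain ⟨q, hq⟩ := hl
    have h2 : k n = 2 * (k₁ n * q) + (k₁ n + k₀) := by simp only [hk, hq]; ring
    have h3 : N n = 2 * (l * n) + N₀ := by simp only [hN]; ring
    omega
  set t : ℕ → ℕ := fun n => (N n - k n) / 2 with ht
  set s : ℕ → ℕ := fun n => N n - t n with hs
  have hts : ∀ n, t n + s n = N n := by intro n; simp only [hs, ht]; omega
  have htsR : ∀ n, (t n : ℝ) + s n = N n := by intro n; exact_mod_cast hts n
  have hkt : ∀ᶠ n in atTop, k n + 2 * t n = N n := by
    filter_upwards [hle] with n hn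
    have := hparity n
    simp only [ht]; omega
  refine ⟨?_, ?_⟩
  · filter_upwards [hkt] with n hn
    exact ⟨t n, hn⟩
  have hstk : ∀ᶠ n in atTop, (s n : ℝ) = t n + k n := by
    filter_upwards [hkt] with n hn
    have := hts n
    exact_mod_cast (by omega : s n = t n + k n)
  have hL := llt t s (α * Real.sqrt l) (by simpa only [htsR] using hNat) (by
    refine (hkN 0).congr' ?_
    filter_upwards [hstk] with n hn
    rw [htsR, hn]; ring_nf)
  simp only [htsR, hts] at hL
  rw [mul_pow, Real.sq_sqrt hlpos.le] at hL
  have hsn : Tendsto (fun n : ℕ => (n : ℝ) / (t n + k n + 1)) atTop (nhds (1 / l)) := by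
    have h1 := (hNn.mul (((tendsto_const_nhds (x := (1 : ℝ))).add hkN1).div_const 2)).add
      (tendsto_const_div_atTop_nhds_zero_nat (1 : ℝ))
    rw [show (2 * l * ((1 + 0) / 2) + 0 : ℝ) = l by ring] at h1
    have h2 := h1.inv₀ hlpos.ne'
    rw [← one_div] at h2
    refine h2.congr' ?_
    filter_upwards [eventually_gt_atTop 0, hNat.eventually_gt_atTop 0, hkt] with n hn hNp hkt
    have hn' : (0 : ℝ) < n := by exact_mod_cast hn
    have hkt' : (N n : ℝ) = k n + 2 * t n := by exact_mod_cast hkt.symm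
    have e : (N n : ℝ) / n * ((1 + (k n : ℝ) / N n) / 2) + 1 / n = (t n + k n + 1) / n := by
      field_simp
      rw [hkt']; ring
    rw [e, inv_div]
  have hall := (hL.mul (hkN 1)).mul hsn
  refine hall.congr' ?_
  filter_upwards [hkt, hNat.eventually_gt_atTop 0] with n hkt hNp
  have hF := Fcoef_mul (N n) (k n) (t n) hkt
  have h3 : 0 < Real.sqrt (N n : ℝ) := Real.sqrt_pos.2 hNp
  have h5 : (0 : ℝ) < t n + k n + 1 := by positivity
  have hF' : (Fcoef (N n) (k n) : ℝ) = (N n).choose (t n) * (k n + 1) / (t n + k n + 1) := by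
    rw [eq_div_iff h5.ne', hF]
  show _ = (n : ℝ) * ((Fcoef (N n) (k n) : ℝ) / 2 ^ (N n))
  rw [hF']
  field_simp

theorem stmt16 (l N₀ k₀ : ℕ) (hl : Odd l) (hl3 : 3 ≤ l)
    (hN₀ : N₀ ≤ 2 * l - 1) (hk₀ : k₀ ≤ l - 1) (α : ℝ) (hα : 0 < α)
    (k₁ : ℕ → ℕ) (hpar : ∀ n, k₁ n % 2 = (N₀ + k₀) % 2)
    (hconv : Tendsto (fun n : ℕ => (k₁ n : ℝ) / Real.sqrt (2 * n)) atTop (nhds α)) :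
    Tendsto (fun n : ℕ => Real.sqrt (n / 2) *
        ((Mmult l (k₁ n * l + k₀) (2 * l * n + N₀) : ℝ) *
          (dimT l (k₁ n * l + k₀) : ℝ) / 2 ^ (2 * l * n + N₀)))
      atTop (nhds
        ((if k₀ = l - 1 then 1 / (l : ℝ) else 2 * ((l : ℝ) - 1 - k₀) / (l : ℝ) ^ 2) *
          (Real.sqrt (2 / π) * (l : ℝ) ^ ((3 : ℝ) / 2) * α ^ 2 *
            Real.exp (-(α ^ 2 * l / 2))))) := by
  have hlpos : (0 : ℝ) < l := by exact_mod_cast (by omega : 0 < l)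
  obtain ⟨hex, hF⟩ := main_F l N₀ k₀ hl hl3 α k₁ hpar hconv
  set N : ℕ → ℕ := fun n => 2 * l * n + N₀ with hN
  set G : ℝ := Real.sqrt (2 / π) * Real.exp (-(α ^ 2 * l / 2)) * (α * Real.sqrt l) * (1 / l) with hG
  have hmod : ∀ n, (k₁ n * l + k₀) % l = k₀ := by
    intro n; rw [Nat.mul_comm, Nat.mul_add_mod]; exact Nat.mod_eq_of_lt (by omega)
  have hdiv : ∀ n, (k₁ n * l + k₀) / l = k₁ n := by
    intro n
    rw [Nat.mul_comm, Nat.mul_add_div (by omega), Nat.div_eq_of_lt (by omega), add_zero]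
  have hs2 : Tendsto (fun n : ℕ => Real.sqrt (2 * n)) atTop atTop :=
    Real.tendsto_sqrt_atTop.comp (tendsto_natCast_atTop_atTop.const_mul_atTop (by norm_num))
  have hk1 : ∀ᶠ n in atTop, k₁ n ≠ 0 := by
    filter_upwards [hconv.eventually_const_lt hα] with n hn h0
    simp [h0] at hn
  have hpow : (l : ℝ) ^ ((3 : ℝ) / 2) = l * Real.sqrt l := by
    rw [show (3 : ℝ) / 2 = 1 + 1 / 2 by norm_num, Real.rpow_add hlpos, Real.rpow_one,
      Real.sqrt_eq_rpow]
  have hcomb : ∀ n : ℕ, 0 < n → ∀ m d q : ℝ, Real.sqrt (n / 2) * (m * d / q) =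
      (n * (m / q)) * (d / Real.sqrt (2 * n)) := by
    intro n hn m d q
    have hn' : (0 : ℝ) < n := by exact_mod_cast hn
    have h2 : 0 < Real.sqrt (2 * n : ℝ) := Real.sqrt_pos.2 (by positivity)
    have h3 : Real.sqrt (n / 2 : ℝ) = n / Real.sqrt (2 * n) := by
      rw [eq_div_iff h2.ne', ← Real.sqrt_mul (by positivity),
        show (n / 2 * (2 * n) : ℝ) = n ^ 2 by ring, Real.sqrt_sq hn'.le]
    rw [h3]
    ring
  by_cases hk : k₀ = l - 1
  · rw [if_pos hk]
    have hd : Tendsto (fun n : ℕ => (l : ℝ) * ((k₁ n : ℝ) + 1) / Real.sqrt (2 * n)) atTop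
        (nhds (l * (α + 0))) := by
      refine ((hconv.add hs2.inv_tendsto_atTop).const_mul (l : ℝ)).congr fun n => ?_
      rw [Pi.inv_apply]; ring
    have hall := hF.mul hd
    have e : G * (l * (α + 0)) = 1 / (l : ℝ) * (Real.sqrt (2 / π) * (l : ℝ) ^ ((3 : ℝ) / 2) * α ^ 2 *
            Real.exp (-(α ^ 2 * l / 2))) := by
      rw [hpow, hG]; field_simp; ring
    rw [e] at hall
    refine hall.congr' ?_
    filter_upwards [hk1, eventually_gt_atTop 0] with n h1 hn
    rw [hcomb n hn]
    unfold Mmult dimT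
    rw [hmod, hdiv, if_pos hk, if_neg h1, if_pos hk]
    push_cast
    rfl
  · rw [if_neg hk]
    have hklt : k₀ < l - 1 := by omega
    have hd : Tendsto (fun n : ℕ => 2 * (k₁ n : ℝ) * l / Real.sqrt (2 * n)) atTop
        (nhds (2 * l * α)) := by
      refine (hconv.const_mul (2 * l : ℝ)).congr fun n => ?_
      ring
    have hdiff : Tendsto (fun n : ℕ => (n : ℝ) * (((l : ℝ) * (Mmult l (k₁ n * l + k₀) (N n) : ℝ) -
        ((l : ℝ) - 1 - k₀) * (Fcoef (N n) ((k₁ n * l + k₀ : ℕ) : ℤ) : ℝ)) / 2 ^ (N n))) atTop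
        (nhds 0) := by
      have hNat : Tendsto (fun n => ((N n : ℝ) + 1)) atTop atTop := by
        refine tendsto_atTop_mono (f := fun n : ℕ => (n : ℝ)) (fun n => ?_)
          tendsto_natCast_atTop_atTop
        have : n ≤ N n + 1 := by
          have := Nat.le_mul_of_pos_left n (by omega : 0 < 2 * l)
          simp only [hN]; omega
        exact_mod_cast this
      have hsq : Tendsto (fun n => (Real.sqrt ((N n : ℝ) + 1))⁻¹) atTop (nhds 0) :=
        (Real.tendsto_sqrt_atTop.comp hNat).inv_tendsto_atTop
      have hb := hsq.const_mul (2 * l * l * 64 : ℝ)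
      rw [mul_zero] at hb
      refine squeeze_zero_norm' ?_ hb
      filter_upwards [hex] with n hn
      obtain ⟨t, ht⟩ := hn
      have hE := Mmult_err (N n) l (k₁ n) k₀ t ht hklt
      have h3 : 0 < Real.sqrt ((N n : ℝ) + 1) := Real.sqrt_pos.2 (by positivity)
      have h4 : Real.sqrt ((N n : ℝ) + 1) ^ 2 = (N n : ℝ) + 1 := Real.sq_sqrt (by positivity)
      have hnN : (n : ℝ) ≤ Real.sqrt ((N n : ℝ) + 1) ^ 2 := by
        rw [h4]
        have : n ≤ N n + 1 := by
          have := Nat.le_mul_of_pos_left n (by omega : 0 < 2 * l)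
          simp only [hN]; omega
        exact_mod_cast this
      rw [Real.norm_eq_abs, abs_mul, abs_div, Nat.abs_cast,
        abs_of_pos (by positivity : (0 : ℝ) < 2 ^ (N n))]
      calc _ ≤ Real.sqrt ((N n : ℝ) + 1) ^ 2 *
            ((2 * l * l * (64 * 2 ^ (N n) / Real.sqrt ((N n : ℝ) + 1) ^ 3)) / 2 ^ (N n)) := by
            gcongr
        _ = _ := by field_simp
    have hM : Tendsto (fun n : ℕ => (n : ℝ) * ((Mmult l (k₁ n * l + k₀) (N n) : ℝ) / 2 ^ (N n)))
        atTop (nhds ((0 + ((l : ℝ) - 1 - k₀) * G) / l)) := by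
      refine ((hdiff.add (hF.const_mul ((l : ℝ) - 1 - k₀))).div_const (l : ℝ)).congr fun n => ?_
      simp only [hN]
      field_simp
      ring
    have hall := hM.mul hd
    have e : (0 + ((l : ℝ) - 1 - k₀) * G) / l * (2 * l * α) =
        2 * ((l : ℝ) - 1 - k₀) / (l : ℝ) ^ 2 * (Real.sqrt (2 / π) * (l : ℝ) ^ ((3 : ℝ) / 2) * α ^ 2 *
            Real.exp (-(α ^ 2 * l / 2))) := by
      rw [hpow, hG]; field_simp; ring
    rw [e] at hall
    refine hall.congr' ?_
    filter_upwards [hk1, eventually_gt_atTop 0] with n h1 hn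
    rw [hcomb n hn]
    have hdim : (dimT l (k₁ n * l + k₀) : ℝ) = 2 * (k₁ n : ℝ) * l := by
      unfold dimT
      rw [hmod, hdiv, if_neg h1, if_neg hk]
      push_cast
      rfl
    rw [hdim]
end

section
/- Let l ≥ 3 be an odd integer. Define the matrix P on the state space {0, 1, …, 3l−2} by: P(k, k+1) = (k+2)/(2(k+1)) for 0 ≤ k ≤ l−2; P(k, k−1) = k/(2(k+1)) for 0 ≤ k ≤ l−2; P(l−1, l) = 1 and P(2l−1, 2l) = 1; P(k, k+1) = 1/2 and P(k, k−1) = 1/2 for every k with l ≤ k ≤ 3l−3 and k ∉ {l−1, 2l−1}; P(3l−2, 3l−3) = 1/2 and P(3l−2, l−1) = 1/2; and all other entries of P are 0. Define the vector p on {0, 1, …, 3l−2} by: p_k = 0 for 0 ≤ k ≤ l−2; p_{l−1} = p_{2l−1} = 1/(2l); p_k = (2l−1−k)/l² for l ≤ k ≤ 2l−2; p_k = (3l−1−k)/l² for 2l ≤ k ≤ 3l−2. Then p is a probability vector stationary for P, i.e. Σ_{k=0}^{3l−2} p_k = 1 and, for every m ∈ {0, …, 3l−2}, Σ_{n=0}^{3l−2}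 p_n · P(n, m) = p_m. -/
/-- The transition matrix of the Plancherel Markov process on the state space
`{0, 1, …, 3l−2}` (entries outside this range are irrelevant and set to `0`). -/
noncomputable def PMat (l : ℕ) (k y : ℕ) : ℝ :=
  if k ≤ l - 2 then
    (if y = k + 1 then ((k : ℝ) + 2) / (2 * ((k : ℝ) + 1))
     else if y + 1 = k then (k : ℝ) / (2 * ((k : ℝ) + 1)) else 0)
  else if k = l - 1 then (if y = l then 1 else 0)
  else if k = 2 * l - 1 then (if y = 2 * l then 1 else 0)
  else if k = 3 * l - 2 then
    (if y = 3 * l - 3 then 1 / 2 else if y = l - 1 then 1 / 2 else 0)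
  else if k ≤ 3 * l - 3 then
    (if y = k + 1 then 1 / 2 else if y + 1 = k then 1 / 2 else 0)
  else 0

/-- The claimed stationary vector on `{0, 1, …, 3l−2}`. -/
noncomputable def pVec (l : ℕ) (k : ℕ) : ℝ :=
  if k ≤ l - 2 then 0
  else if k = l - 1 then 1 / (2 * (l : ℝ))
  else if k = 2 * l - 1 then 1 / (2 * (l : ℝ))
  else if k ≤ 2 * l - 2 then (2 * (l : ℝ) - 1 - k) / (l : ℝ) ^ 2
  else (3 * (l : ℝ) - 1 - k) / (l : ℝ) ^ 2

theorem aux_zero (a n m : ℕ) (h : m ≤ a + 1) : pVec (a+3) n * PMat (a+3) n m = 0 := by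
  unfold pVec PMat
  split_ifs <;> first | (exfalso; omega) | simp

theorem aux_sum (a : ℕ) : ∑ k ∈ Finset.range (3 * (a+3) - 1), pVec (a+3) k = 1 := by
  have e : 3 * (a+3) - 1 = (((a + 2) + 1) + (a + 2)) + 1 + (a + 2) := by omega
  rw [e, Finset.sum_range_add, Finset.sum_range_succ, Finset.sum_range_add,
    Finset.sum_range_succ]
  have h1 : ∑ k ∈ Finset.range (a+2), pVec (a+3) k = 0 := by
    apply Finset.sum_eq_zero
    intro k hk
    rw [Finset.mem_range] at hk
    unfold pVec
    rw [if_pos (by omega)]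
  have g : ∀ N : ℕ, ∑ x ∈ Finset.range N, ((a : ℝ) + 2 - x) = N * (a+2) - N * (N-1) / 2 := by
    intro N
    induction N with
    | zero => simp
    | succ N ih => rw [Finset.sum_range_succ, ih]; push_cast; ring
  have h2 : ∑ x ∈ Finset.range (a+2), pVec (a+3) (a + 2 + 1 + x)
      = ∑ x ∈ Finset.range (a+2), ((a : ℝ) + 2 - x) / ((a:ℝ)+3)^2 := by
    apply Finset.sum_congr rfl
    intro k hk
    rw [Finset.mem_range] at hk
    unfold pVec
    rw [if_neg (by omega), if_neg (by omega), if_neg (by omega), if_pos (by omega)]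
    push_cast
    ring
  have h3 : ∑ x ∈ Finset.range (a+2), pVec (a+3) (a + 2 + 1 + (a + 2) + 1 + x)
      = ∑ x ∈ Finset.range (a+2), ((a : ℝ) + 2 - x) / ((a:ℝ)+3)^2 := by
    apply Finset.sum_congr rfl
    intro k hk
    rw [Finset.mem_range] at hk
    unfold pVec
    rw [if_neg (by omega), if_neg (by omega), if_neg (by omega), if_neg (by omega)]
    push_cast
    ring
  have h4 : pVec (a+3) (a+2) = 1 / (2 * ((a:ℝ)+3)) := by
    unfold pVec
    rw [if_neg (by omega), if_pos (by omega)]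
    push_cast
    ring
  have h5 : pVec (a+3) (a+2+1+(a+2)) = 1 / (2 * ((a:ℝ)+3)) := by
    unfold pVec
    rw [if_neg (by omega), if_neg (by omega), if_pos (by omega)]
    push_cast
    ring
  rw [h1, h2, h3, h4, h5, ← Finset.sum_div, g]
  have : (a:ℝ) + 3 ≠ 0 := by positivity
  push_cast
  field_simp
  ring

set_option maxHeartbeats 4000000 in
theorem aux_stat (a m : ℕ) (hm : m < 3 * (a+3) - 1) :
    ∑ n ∈ Finset.range (3 * (a+3) - 1), pVec (a+3) n * PMat (a+3) n m = pVec (a+3) m := by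
  have h0 : (a:ℝ) + 3 ≠ 0 := by positivity
  by_cases c1 : m ≤ a + 1
  · rw [Finset.sum_eq_zero (fun n _ => aux_zero a n m c1)]
    unfold pVec
    rw [if_pos (by omega)]
  by_cases c2 : m = a + 2
  · subst c2
    rw [Finset.sum_eq_add (a+3) (3*a+7) (by omega)]
    · have e1 : pVec (a+3) (a+3) = ((a:ℝ)+2)/((a:ℝ)+3)^2 := by
        unfold pVec
        rw [if_neg (by omega), if_neg (by omega), if_neg (by omega), if_pos (by omega)]
        push_cast; ring
      have e2 : pVec (a+3) (3*a+7) = 1/((a:ℝ)+3)^2 := by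
        unfold pVec
        rw [if_neg (by omega), if_neg (by omega), if_neg (by omega), if_neg (by omega)]
        push_cast; ring
      have e3 : pVec (a+3) (a+2) = 1/(2*((a:ℝ)+3)) := by
        unfold pVec
        rw [if_neg (by omega), if_pos (by omega)]
        push_cast; ring
      have e4 : PMat (a+3) (a+3) (a+2) = 1/2 := by
        unfold PMat
        split_ifs <;> first | (exfalso; omega) | rfl
      have e5 : PMat (a+3) (3*a+7) (a+2) = 1/2 := by
        unfold PMat
        split_ifs <;> first | (exfalso; omega) | rfl
      rw [e1, e2, e3, e4, e5]
      field_simp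
      ring
    · intro c hc hne
      rw [Finset.mem_range] at hc
      unfold pVec PMat
      split_ifs <;> first | (exfalso; omega) | simp
    · intro h; exact absurd (Finset.mem_range.2 (by omega)) h
    · intro h; exact absurd (Finset.mem_range.2 (by omega)) h
  obtain ⟨j, rfl⟩ : ∃ j, m = a + 3 + j := ⟨m - (a+3), by omega⟩
  by_cases c3 : j = 2 * a + 4
  · subst c3
    rw [Finset.sum_eq_single (3*a+6)]
    · unfold pVec PMat
      split_ifs <;> first | (exfalso; omega) | (push_cast; field_simp; ring)
    · intro c hc hne
      rw [Finset.mem_range] at hc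
      unfold pVec PMat
      split_ifs <;> first | (exfalso; omega) | simp
    · intro h; exact absurd (Finset.mem_range.2 (by omega)) h
  rw [Finset.sum_eq_add (a+2+j) (a+4+j) (by omega)]
  · have q1 : PMat (a+3) (a+2+j) (a+3+j) = if j = 0 then 1 else if j = a + 3 then 1 else 1/2 := by
      unfold PMat
      split_ifs <;> first | (exfalso; omega) | rfl
    have q2 : PMat (a+3) (a+4+j) (a+3+j) = if j = a + 1 then 0 else 1/2 := by
      unfold PMat
      split_ifs <;> first | (exfalso; omega) | rfl
    have v : ∀ i, pVec (a+3) (a+2+i) = if i = 0 then 1/(2*((a:ℝ)+3)) else if i = a + 3 then 1/(2*((a:ℝ)+3))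
        else if i < a + 3 then ((a:ℝ)+3 - i)/((a:ℝ)+3)^2 else (2*((a:ℝ)+3) - i)/((a:ℝ)+3)^2 := by
      intro i
      unfold pVec
      split_ifs <;> first | (exfalso; omega) | (push_cast; ring)
    have r1 : a + 4 + j = a + 2 + (j+2) := by omega
    have r2 : a + 3 + j = a + 2 + (j+1) := by omega
    rw [q1, q2, r1, r2, v, v, v]
    by_cases d1 : j = 0
    · subst d1
      split_ifs <;> first | (exfalso; omega) | (push_cast; field_simp; ring)
    by_cases d2 : j = a + 1
    · subst d2
      split_ifs <;> first | (exfalso; omega) | (push_cast; field_simp; ring)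
    by_cases d3 : j = a + 2
    · subst d3
      split_ifs <;> first | (exfalso; omega) | (push_cast; field_simp; ring)
    by_cases d4 : j = a + 3
    · subst d4
      split_ifs <;> first | (exfalso; omega) | (push_cast; field_simp; ring)
    split_ifs <;> first | (exfalso; omega) | (push_cast; field_simp; ring)
  · intro c hc hne
    rw [Finset.mem_range] at hc
    unfold pVec PMat
    split_ifs <;> first | (exfalso; omega) | simp
  · intro h; exact absurd (Finset.mem_range.2 (by omega)) h
  · intro h; exact absurd (Finset.mem_range.2 (by omega)) h

theorem stmt18 (l : ℕ) (hl : Odd l) (hl3 : 3 ≤ l) :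
    (∑ k ∈ Finset.range (3 * l - 1), pVec l k = 1) ∧
    (∀ m ∈ Finset.range (3 * l - 1),
      ∑ n ∈ Finset.range (3 * l - 1), pVec l n * PMat l n m = pVec l m) := by
  obtain ⟨a, rfl⟩ : ∃ a, l = a + 3 := ⟨l - 3, by omega⟩
  exact ⟨aux_sum a, fun m hm => aux_stat a m (Finset.mem_range.1 hm)⟩
end

section
/- Let l ≥ 3 be an odd integer. Define the matrix P on the state space {0, 1, …, l−2} by: P(k, k+1) = sin(π(k+2)/l) / ( 2 cos(π/l) · sin(π(k+1)/l) ) for 0 ≤ k ≤ l−3; P(k, k−1) = sin(πk/l) / ( 2 cos(π/l) · sin(π(k+1)/l) ) for 1 ≤ k ≤ l−3; P(l−2, l−3) = 1; and all other entries of P are 0. Define the vector p on {0, 1, …, l−2} by p_j := (2/l) · sin²(π(j+1)/l). Then p is a probability vector stationary for P, i.e. Σ_{j=0}^{l−2} p_j = 1 and, for every m ∈ {0, …, l−2}, Σ_{n=0}^{l−2} p_n · P(n, m) = p_m. -/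
open Real

/-- The transition matrix of the quantum Plancherel Markov process on the state space
`{0, 1, …, l−2}` (entries outside this range are irrelevant and set to `0`):
`P(k, k+1) = sin(π(k+2)/l)/(2 cos(π/l) sin(π(k+1)/l))` for `0 ≤ k ≤ l−3`,
`P(k, k−1) = sin(πk/l)/(2 cos(π/l) sin(π(k+1)/l))` for `1 ≤ k ≤ l−3`, and
`P(l−2, l−3) = 1`. -/
noncomputable def PMatQ (l : ℕ) (k y : ℕ) : ℝ :=
  if k ≤ l - 3 then
    (if y = k + 1 then
      Real.sin (π * ((k : ℝ) + 2) / l) / (2 * Real.cos (π / l) * Real.sin (π * ((k : ℝ) + 1) / l))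
     else if y + 1 = k then
      Real.sin (π * (k : ℝ) / l) / (2 * Real.cos (π / l) * Real.sin (π * ((k : ℝ) + 1) / l))
     else 0)
  else if k = l - 2 then (if y = l - 3 then 1 else 0)
  else 0

/-- The claimed stationary vector `p_j = (2/l) sin²(π(j+1)/l)` on `{0, 1, …, l−2}`. -/
noncomputable def pVecQ (l : ℕ) (j : ℕ) : ℝ :=
  (2 / (l : ℝ)) * Real.sin (π * ((j : ℝ) + 1) / l) ^ 2


lemma aux_sum_s19 (t : ℝ) (N : ℕ) :
    4 * Real.sin t * ∑ j ∈ Finset.range N, Real.sin (((j : ℝ) + 1) * t) ^ 2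
      = (2 * N + 1) * Real.sin t - Real.sin ((2 * N + 1) * t) := by
  induction N with
  | zero => simp
  | succ N ih =>
    rw [Finset.sum_range_succ, mul_add, ih]
    have h1 : (2 * (N : ℝ) + 1) * t = 2 * (((N : ℝ) + 1) * t) - t := by ring
    have h2 : (2 * ((N + 1 : ℕ) : ℝ) + 1) * t = 2 * (((N : ℝ) + 1) * t) + t := by
      push_cast; ring
    rw [h1, h2, Real.sin_sub, Real.sin_add, Real.cos_two_mul, Real.cos_sq']
    push_cast
    ring

lemma aux_term (l : ℕ) (hl3 : 3 ≤ l) (n m : ℕ) (hn : n < l - 1) (hm : m < l - 1) :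
    pVecQ l n * PMatQ l n m =
      (if n + 1 = m then Real.sin (π * ((m : ℝ) + 1) / l) * Real.sin (π * (m : ℝ) / l)
          / (l * Real.cos (π / l)) else 0) +
      (if n = m + 1 then Real.sin (π * ((m : ℝ) + 1) / l) * Real.sin (π * ((m : ℝ) + 2) / l)
          / (l * Real.cos (π / l)) else 0) := by
  have hl0 : (0 : ℝ) < l := by positivity
  have h3 : (3 : ℝ) ≤ l := by exact_mod_cast hl3
  have hc : 0 < Real.cos (π / l) := by
    apply Real.cos_pos_of_mem_Ioo
    constructor
    · have : 0 < π / l := by positivity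
      linarith [Real.pi_pos]
    · exact div_lt_div_of_pos_left Real.pi_pos (by norm_num) (by linarith)
  have hs : 0 < Real.sin (π * ((n : ℝ) + 1) / l) := by
    apply Real.sin_pos_of_pos_of_lt_pi
    · positivity
    · rw [div_lt_iff₀ hl0]
      have : (n : ℝ) + 1 < l := by
        have : n + 1 < l := by omega
        exact_mod_cast this
      exact mul_lt_mul_of_pos_left this Real.pi_pos
  unfold pVecQ PMatQ
  by_cases h : n ≤ l - 3
  · rw [if_pos h]
    by_cases h1 : m = n + 1
    · subst h1
      rw [if_pos rfl, if_pos rfl, if_neg (by omega)]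
      push_cast
      have e : π * ((n : ℝ) + 1 + 1) / l = π * ((n : ℝ) + 2) / l := by ring
      rw [e]
      field_simp
      ring
    · rw [if_neg h1, if_neg (by omega : ¬ n + 1 = m)]
      by_cases h2 : m + 1 = n
      · subst h2
        rw [if_pos rfl, if_pos rfl]
        push_cast at hs ⊢
        have e : π * ((m : ℝ) + 1 + 1) / l = π * ((m : ℝ) + 2) / l := by ring
        rw [e] at hs ⊢
        field_simp
        ring
      · rw [if_neg h2, if_neg (fun h => h2 h.symm)]
        ring
  · have hn2 : n = l - 2 := by omega
    rw [if_neg h, if_pos hn2, if_neg (by omega : ¬ n + 1 = m)]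
    by_cases h2 : n = m + 1
    · rw [if_pos (by omega), if_pos h2]
      have hlm : (l : ℝ) = m + 3 := by
        have : l = m + 3 := by omega
        exact_mod_cast this
      have hnm : (n : ℝ) = m + 1 := by exact_mod_cast h2
      have e1 : π * ((n : ℝ) + 1) / l = π - π / l := by
        rw [hnm]; field_simp; rw [hlm]; ring
      have e2 : π * ((m : ℝ) + 2) / l = π - π / l := by
        field_simp; rw [hlm]; ring
      have e3 : π * ((m : ℝ) + 1) / l = π - 2 * (π / l) := by
        field_simp; rw [hlm]; ring
      rw [e1, e2, e3, Real.sin_pi_sub, Real.sin_pi_sub, Real.sin_two_mul]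
      field_simp
      ring
    · rw [if_neg (by omega), if_neg h2]
      ring

theorem stmt19 (l : ℕ) (hl : Odd l) (hl3 : 3 ≤ l) :
    (∑ j ∈ Finset.range (l - 1), pVecQ l j = 1) ∧
    (∀ m ∈ Finset.range (l - 1),
      ∑ n ∈ Finset.range (l - 1), pVecQ l n * PMatQ l n m = pVecQ l m) := by
  have hl0 : (0 : ℝ) < l := by positivity
  have h3 : (3 : ℝ) ≤ l := by exact_mod_cast hl3
  have hpl : 0 < π / l := by positivity
  have hlt : π / l < π / 2 := div_lt_div_of_pos_left Real.pi_pos (by norm_num) (by linarith)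
  have hc : 0 < Real.cos (π / l) := by
    apply Real.cos_pos_of_mem_Ioo
    constructor <;> linarith [Real.pi_pos]
  have hs : 0 < Real.sin (π / l) := by
    apply Real.sin_pos_of_pos_of_lt_pi <;> linarith [Real.pi_pos]
  constructor
  · have h := aux_sum_s19 (π / l) (l - 1)
    have hcast : ((l - 1 : ℕ) : ℝ) = l - 1 := by
      rw [Nat.cast_sub (by omega)]; simp
    have e : (2 * ((l - 1 : ℕ) : ℝ) + 1) * (π / l) = 2 * π - π / l := by
      rw [hcast]; field_simp; ring
    rw [e, Real.sin_two_pi_sub, hcast] at h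
    unfold pVecQ
    rw [← Finset.mul_sum]
    have e2 : ∀ j : ℕ, π * ((j : ℝ) + 1) / l = ((j : ℝ) + 1) * (π / l) := fun j => by ring
    simp only [e2]
    have h5 : ∑ j ∈ Finset.range (l - 1), Real.sin (((j : ℝ) + 1) * (π / l)) ^ 2 = l / 2 := by
      apply mul_left_cancel₀ (mul_pos four_pos hs).ne'
      rw [h]; ring
    rw [h5]
    field_simp
  · intro m hm
    have hm' := Finset.mem_range.1 hm
    rw [Finset.sum_congr rfl (fun n hn => aux_term l hl3 n m (Finset.mem_range.1 hn) hm'),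
      Finset.sum_add_distrib]
    have hA : (∑ n ∈ Finset.range (l - 1), (if n + 1 = m then
        Real.sin (π * ((m : ℝ) + 1) / l) * Real.sin (π * (m : ℝ) / l)
          / (l * Real.cos (π / l)) else 0)) =
        Real.sin (π * ((m : ℝ) + 1) / l) * Real.sin (π * (m : ℝ) / l)
          / (l * Real.cos (π / l)) := by
      rcases m with _ | k
      · simp
      · simp only [Nat.add_right_cancel_iff]
        rw [Finset.sum_ite_eq', if_pos (Finset.mem_range.2 (by omega))]
    have hB : (∑ n ∈ Finset.range (l - 1), (if n = m + 1 then
        Real.sin (π * ((m : ℝ) + 1) / l) * Real.sin (π * ((m : ℝ) + 2) / l)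
          / (l * Real.cos (π / l)) else 0)) =
        Real.sin (π * ((m : ℝ) + 1) / l) * Real.sin (π * ((m : ℝ) + 2) / l)
          / (l * Real.cos (π / l)) := by
      rw [Finset.sum_ite_eq']
      split_ifs with h
      · rfl
      · have hlm : (m : ℝ) + 2 = l := by
          have : m + 2 = l := by
            rw [Finset.mem_range] at h
            omega
          exact_mod_cast this
        rw [hlm, mul_div_cancel_right₀ π hl0.ne', Real.sin_pi]
        simp
    rw [hA, hB]
    unfold pVecQ
    have e1 : π * (m : ℝ) / l = π * ((m : ℝ) + 1) / l - π / l := by ring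
    have e2 : π * ((m : ℝ) + 2) / l = π * ((m : ℝ) + 1) / l + π / l := by ring
    rw [e1, e2, Real.sin_sub, Real.sin_add]
    field_simp
    ring
end
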